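/- Fix 0 < c < 1. Then lim_{ν→∞} (π/2)·ν·√(1−c²)·exp(2ν√(1−c²) − 2ν·log(1/c + √(1/c² − 1)))·M²(ν, cν) = 1. -/

import Mathlib

open Real MeasureTheory Set Filter

/-- Integral representation of the modified Bessel function `K₀`. -/
noncomputable def K0 (x : ℝ) : ℝ := ∫ t in Ioi (0:ℝ), Real.exp (-x * Real.cosh t)

/-- Bessel modulus squared, via Nicholson's formula. -/
noncomputable def M2 (ν z : ℝ) : ℝ :=
  (8 / π ^ 2) * ∫ t in Ioi (0:ℝ), K0 (2 * z * Real.sinh t) * Real.cosh (2 * ν * t)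

/-- A function vanishing to second order at `x₀` divided by the square tends to half the
second derivative. -/
theorem tendsto_div_sq_of_hasDerivAt {f f' : ℝ → ℝ} {x₀ σ : ℝ}
    (hf : ∀ x, HasDerivAt f (f' x) x) (hf' : HasDerivAt f' (2 * σ) x₀)
    (h0 : f x₀ = 0) (h0' : f' x₀ = 0) :
    Tendsto (fun v => f (x₀ + v) / v ^ 2) (nhdsWithin 0 {0}ᶜ) (nhds σ) := by
  have hcont : Continuous f := continuous_iff_continuousAt.2 fun x => (hf x).continuousAt
  refine HasDerivAt.lhopital_zero_nhdsNE (f' := fun v => f' (x₀ + v)) (g' := fun v => 2 * v)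
    (Eventually.of_forall fun v => (hf (x₀ + v)).comp_const_add x₀ v)
    (Eventually.of_forall fun v => by simpa using hasDerivAt_pow 2 v) ?_ ?_ ?_ ?_
  · filter_upwards [self_mem_nhdsWithin] with v hv
    simpa using hv
  · have : Tendsto (fun v => f (x₀ + v)) (nhds 0) (nhds (f (x₀ + 0))) :=
      (by fun_prop : Continuous fun v => f (x₀ + v)).tendsto 0
    rw [add_zero, h0] at this
    exact this.mono_left nhdsWithin_le_nhds
  · have : Tendsto (fun v : ℝ => v ^ 2) (nhds 0) (nhds (0 ^ 2)) := (continuous_pow 2).tendsto 0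
    rw [zero_pow two_ne_zero] at this
    exact this.mono_left nhdsWithin_le_nhds
  · have h := (hasDerivAt_iff_tendsto_slope_zero.1 hf').const_mul (1 / 2)
    rw [show 1 / 2 * (2 * σ) = σ by ring] at h
    refine h.congr fun v => ?_
    rw [h0', smul_eq_mul, sub_zero, div_eq_mul_inv (f' _), mul_inv]
    ring

/-- A lower bound on the second derivative gives a quadratic lower bound around a critical
zero. -/
theorem mul_sq_le_of_le_deriv2 {f f' f'' : ℝ → ℝ} {x₀ m : ℝ} {D : Set ℝ}
    (hD : IsOpen D) (hDc : Convex ℝ D) (hx₀ : x₀ ∈ D)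
    (hf : ∀ x, HasDerivAt f (f' x) x) (hf' : ∀ x, HasDerivAt f' (f'' x) x)
    (h0 : f x₀ = 0) (h0' : f' x₀ = 0) (hm : ∀ x ∈ D, 2 * m ≤ f'' x) {x : ℝ} (hx : x ∈ D) :
    m * (x - x₀) ^ 2 ≤ f x := by
  have hg : ∀ y, HasDerivAt (fun y => f y - m * (y - x₀) ^ 2) (f' y - m * (2 * (y - x₀))) y := by
    intro y
    have h := ((((hasDerivAt_id y).sub_const x₀).pow 2).const_mul m)
    exact (hf y).sub (by simpa using h)
  have hg' : ∀ y, HasDerivAt (fun y => f' y - m * (2 * (y - x₀))) (f'' y - m * 2) y := by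
    intro y
    have h := (((hasDerivAt_id y).sub_const x₀).const_mul 2).const_mul m
    exact (hf' y).sub (by simpa using h)
  have hconv : ConvexOn ℝ D (fun y => f y - m * (y - x₀) ^ 2) := by
    refine convexOn_of_hasDerivWithinAt2_nonneg hDc
      (fun y _ => (hg y).continuousAt.continuousWithinAt)
      (fun y _ => (hg y).hasDerivWithinAt) (fun y _ => (hg' y).hasDerivWithinAt) ?_
    intro y hy
    have := hm y (interior_subset hy)
    linarith
  have hmin := hconv.isMinOn_of_rightDeriv_eq_zero (x := x₀) (by rwa [hD.interior_eq])
    (by rw [(hg x₀).hasDerivWithinAt.derivWithin (uniqueDiffWithinAt_Ioi x₀), h0']; ring)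
  have := hmin hx
  simp only [mem_ofPred_eq, h0] at this
  linarith

/-- Laplace's method at a nondegenerate interior minimum, with a parameter-dependent bounded
amplitude. -/
theorem tendsto_sqrt_mul_integral_exp_neg_mul {S : Set ℝ} {φ : ℝ → ℝ} {h : ℝ → ℝ → ℝ}
    {x₀ m σ C L : ℝ} (hS : S ∈ nhds x₀) (hSm : MeasurableSet S)
    (hφ : Measurable φ) (hh : ∀ ν, Measurable (h ν))
    (hC : ∀ᶠ ν in atTop, ∀ t ∈ S, |h ν t| ≤ C)
    (hm : 0 < m) (hφm : ∀ t ∈ S, m * (t - x₀) ^ 2 ≤ φ t)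
    (hσ : Tendsto (fun v => φ (x₀ + v) / v ^ 2) (nhdsWithin 0 {0}ᶜ) (nhds σ))
    (hL : ∀ y, Tendsto (fun ν => h ν (x₀ + y / √ν)) atTop (nhds L)) :
    Tendsto (fun ν => √ν * ∫ t in S, Real.exp (-ν * φ t) * h ν t) atTop
      (nhds (√(π / σ) * L)) := by
  have hscale : ∀ ν : ℝ, √ν * ∫ t in S, Real.exp (-ν * φ t) * h ν t
      = ∫ y, S.indicator (fun t => Real.exp (-ν * φ t) * h ν t) (x₀ + y / √ν) := by
    intro ν
    rw [MeasureTheory.Measure.integral_comp_div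
      (fun u => S.indicator (fun t => Real.exp (-ν * φ t) * h ν t) (x₀ + u)),
      integral_add_left_eq_self (fun u => S.indicator (fun t => Real.exp (-ν * φ t) * h ν t) u),
      integral_indicator hSm, smul_eq_mul, abs_of_nonneg (Real.sqrt_nonneg ν)]
  have hdiv : ∀ y : ℝ, Tendsto (fun ν : ℝ => y / √ν) atTop (nhds 0) := fun y =>
    tendsto_const_nhds.div_atTop Real.tendsto_sqrt_atTop
  simp_rw [hscale]
  have hgauss : √(π / σ) * L = ∫ y, Real.exp (-σ * y ^ 2) * L := by
    rw [integral_mul_const, integral_gaussian]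
  rw [hgauss]
  refine tendsto_integral_filter_of_dominated_convergence
    (fun y => Real.exp (-m * y ^ 2) * C) ?_ ?_ ((integrable_exp_neg_mul_sq hm).mul_const C) ?_
  · refine Eventually.of_forall fun ν => Measurable.aestronglyMeasurable ?_
    have : Measurable (S.indicator (fun t => Real.exp (-ν * φ t) * h ν t)) :=
      (((hφ.const_mul (-ν)).exp).mul (hh ν)).indicator hSm
    exact this.comp (by fun_prop)
  · filter_upwards [hC, eventually_gt_atTop 0] with ν hν hν0
    refine Eventually.of_forall fun y => ?_
    by_cases hy : x₀ + y / √ν ∈ S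
    · rw [indicator_of_mem hy, norm_mul, Real.norm_eq_abs, Real.norm_eq_abs, Real.abs_exp]
      refine mul_le_mul (Real.exp_le_exp.2 ?_) (hν _ hy) (abs_nonneg _) (Real.exp_pos _).le
      have h1 := mul_le_mul_of_nonneg_left (hφm _ hy) hν0.le
      have h2 : ν * (m * (x₀ + y / √ν - x₀) ^ 2) = m * y ^ 2 := by
        rw [add_sub_cancel_left, div_pow, Real.sq_sqrt hν0.le]
        field_simp
      linarith
    · rw [indicator_of_notMem hy, norm_zero]
      have : 0 ≤ C := (abs_nonneg _).trans (hν x₀ (mem_of_mem_nhds hS))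
      positivity
  · have hne : ∀ᵐ y : ℝ, y ≠ 0 := by simp [ae_iff, measure_singleton]
    filter_upwards [hne] with y hy
    have hto : Tendsto (fun ν : ℝ => y / √ν) atTop (nhdsWithin 0 {0}ᶜ) := by
      refine tendsto_nhdsWithin_iff.2 ⟨hdiv y, ?_⟩
      filter_upwards [eventually_gt_atTop 0] with ν hν
      exact div_ne_zero hy (Real.sqrt_pos.2 hν).ne'
    have hexp : Tendsto (fun ν : ℝ => -ν * φ (x₀ + y / √ν)) atTop (nhds (-σ * y ^ 2)) := by
      refine ((hσ.comp hto).neg.mul_const (y ^ 2)).congr' ?_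
      filter_upwards [eventually_gt_atTop 0] with ν hν
      simp only [Function.comp_apply, div_pow, Real.sq_sqrt hν.le]
      field_simp
    have hmem : ∀ᶠ ν : ℝ in atTop, x₀ + y / √ν ∈ S := by
      have : Tendsto (fun ν : ℝ => x₀ + y / √ν) atTop (nhds (x₀ + 0)) := (hdiv y).const_add x₀
      rw [add_zero] at this
      exact this hS
    refine ((Real.continuous_exp.tendsto _ |>.comp hexp).mul (hL y)).congr' ?_
    filter_upwards [hmem] with ν hν
    rw [indicator_of_mem hν]
    rfl

theorem half_sq_le_cosh_sub_one (t : ℝ) : 1 / 2 * (t - 0) ^ 2 ≤ Real.cosh t - 1 :=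
  mul_sq_le_of_le_deriv2 (f := fun t => Real.cosh t - 1) (f' := Real.sinh) (f'' := Real.cosh)
    isOpen_univ convex_univ (mem_univ 0) (fun x => (Real.hasDerivAt_cosh x).sub_const 1)
    Real.hasDerivAt_sinh (by simp) (by simp)
    (fun x _ => by linarith [Real.one_le_cosh x]) (mem_univ t)

theorem integral_exp_neg_mul_cosh_sub_one (x : ℝ) :
    ∫ t, Real.exp (-x * (Real.cosh t - 1)) = 2 * (Real.exp x * K0 x) := by
  have h := integral_comp_abs (f := fun t => Real.exp (-x * (Real.cosh t - 1)))
  simp only [Real.cosh_abs] at h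
  rw [h, K0, ← integral_const_mul (Real.exp x)]
  congr 2
  funext t
  rw [← Real.exp_add]
  congr 1
  ring

theorem measurable_K0 : Measurable K0 := by
  have : StronglyMeasurable (Function.uncurry fun x t : ℝ => Real.exp (-x * Real.cosh t)) :=
    Measurable.stronglyMeasurable (by unfold Function.uncurry; fun_prop)
  exact (this.integral_prod_right (ν := volume.restrict (Ioi 0))).measurable

theorem K0_nonneg (x : ℝ) : 0 ≤ K0 x :=
  integral_nonneg fun _ => (Real.exp_pos _).le

theorem sqrt_mul_exp_mul_K0_le {x : ℝ} (hx : 0 < x) : √x * (Real.exp x * K0 x) ≤ √(π / 2) := by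
  have hle : ∫ t, Real.exp (-x * (Real.cosh t - 1)) ≤ ∫ t, Real.exp (-(x / 2) * t ^ 2) := by
    refine integral_mono_of_nonneg (Eventually.of_forall fun t => (Real.exp_pos _).le)
      (integrable_exp_neg_mul_sq (by positivity)) (Eventually.of_forall fun t => ?_)
    refine Real.exp_le_exp.2 ?_
    have := mul_le_mul_of_nonneg_left (half_sq_le_cosh_sub_one t) hx.le
    rw [sub_zero] at this
    linarith
  rw [integral_exp_neg_mul_cosh_sub_one, integral_gaussian] at hle
  have h2 : √x * √(π / (x / 2)) = 2 * √(π / 2) := by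
    rw [← Real.sqrt_mul hx.le, show x * (π / (x / 2)) = 2 ^ 2 * (π / 2) by field_simp,
      Real.sqrt_mul (by positivity), Real.sqrt_sq two_pos.le]
  have := mul_le_mul_of_nonneg_left hle (Real.sqrt_nonneg x)
  linarith

theorem tendsto_sqrt_mul_exp_mul_K0 :
    Tendsto (fun x => √x * (Real.exp x * K0 x)) atTop (nhds √(π / 2)) := by
  have h := tendsto_sqrt_mul_integral_exp_neg_mul (S := univ) (φ := fun t => Real.cosh t - 1)
    (h := fun _ _ => 1) (x₀ := 0) (m := 1 / 2) (σ := 1 / 2) (C := 1) (L := 1) univ_mem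
    MeasurableSet.univ (by fun_prop) (fun _ => measurable_const) (by simp) (by norm_num)
    (fun t _ => half_sq_le_cosh_sub_one t)
    (tendsto_div_sq_of_hasDerivAt (f := fun t => Real.cosh t - 1) (f' := Real.sinh)
      (fun x => (Real.hasDerivAt_cosh x).sub_const 1)
      (by simpa using Real.hasDerivAt_sinh 0) (by simp) (by simp))
    (fun _ => tendsto_const_nhds)
  have hval : √(π / (1 / 2)) * 1 = 2 * √(π / 2) := by
    rw [show π / (1 / 2) = 2 ^ 2 * (π / 2) by ring, Real.sqrt_mul (by positivity),
      Real.sqrt_sq two_pos.le, mul_one]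
  rw [hval] at h
  simp only [mul_one, setIntegral_univ, integral_exp_neg_mul_cosh_sub_one] at h
  have h' := h.const_mul (1 / 2)
  rw [← mul_assoc, show (1 / 2 : ℝ) * 2 = 1 by norm_num, one_mul] at h'
  refine h'.congr fun x => ?_
  ring

/-- The subexponential factor of the integrand in Nicholson's formula at `z = c * ν`. -/
noncomputable def nicholsonAmplitude (c ν t : ℝ) : ℝ :=
  (√(2 * (c * Real.sinh t)))⁻¹ *
    (√(2 * (c * ν) * Real.sinh t) *
      (Real.exp (2 * (c * ν) * Real.sinh t) * K0 (2 * (c * ν) * Real.sinh t))) *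
    ((1 + Real.exp (-4 * ν * t)) / 2)

theorem measurable_nicholsonAmplitude (c ν : ℝ) : Measurable (nicholsonAmplitude c ν) := by
  have := measurable_K0
  unfold nicholsonAmplitude
  fun_prop

theorem nicholsonAmplitude_nonneg (c ν t : ℝ) : 0 ≤ nicholsonAmplitude c ν t := by
  have := K0_nonneg (2 * (c * ν) * Real.sinh t)
  unfold nicholsonAmplitude
  positivity

theorem nicholsonAmplitude_le {c ν t : ℝ} (hc : 0 < c) (hν : 0 < ν) (ht : 0 < t) :
    nicholsonAmplitude c ν t ≤ (√(2 * (c * Real.sinh t)))⁻¹ * √(π / 2) := by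
  have hs := Real.sinh_pos_iff.2 ht
  have h1 := sqrt_mul_exp_mul_K0_le (x := 2 * (c * ν) * Real.sinh t) (by positivity)
  have h2 : (1 + Real.exp (-4 * ν * t)) / 2 ≤ 1 := by
    have : Real.exp (-4 * ν * t) ≤ 1 := Real.exp_le_one_iff.2 (by nlinarith [mul_pos hν ht])
    linarith
  unfold nicholsonAmplitude
  refine (mul_le_of_le_one_right ?_ h2).trans (by gcongr)
  have := K0_nonneg (2 * (c * ν) * Real.sinh t)
  positivity

theorem tendsto_nicholsonAmplitude {c t₀ : ℝ} (hc : 0 < c) (ht₀ : 0 < t₀) (y : ℝ) :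
    Tendsto (fun ν => nicholsonAmplitude c ν (t₀ + y / √ν)) atTop
      (nhds ((√(2 * (c * Real.sinh t₀)))⁻¹ * √(π / 2) * (1 / 2))) := by
  have hs := Real.sinh_pos_iff.2 ht₀
  have ht : Tendsto (fun ν : ℝ => t₀ + y / √ν) atTop (nhds t₀) := by
    simpa using (tendsto_const_nhds.div_atTop Real.tendsto_sqrt_atTop).const_add t₀
  have hsinh := (Real.continuous_sinh.tendsto t₀).comp ht
  have hX : Tendsto (fun ν : ℝ => 2 * (c * ν) * Real.sinh (t₀ + y / √ν)) atTop atTop := by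
    have : Tendsto (fun ν : ℝ => 2 * (c * ν)) atTop atTop :=
      (tendsto_id.const_mul_atTop hc).const_mul_atTop two_pos
    exact this.atTop_mul_pos hs hsinh
  have hE : Tendsto (fun ν : ℝ => Real.exp (-4 * ν * (t₀ + y / √ν))) atTop (nhds 0) := by
    refine Real.tendsto_exp_atBot.comp ?_
    have : Tendsto (fun ν : ℝ => -4 * ν) atTop atBot :=
      tendsto_id.const_mul_atTop_of_neg (by norm_num)
    exact this.atBot_mul_pos ht₀ ht
  have hg : Tendsto (fun ν : ℝ => (√(2 * (c * Real.sinh (t₀ + y / √ν))))⁻¹) atTop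
      (nhds (√(2 * (c * Real.sinh t₀)))⁻¹) :=
    (((hsinh.const_mul c).const_mul 2).sqrt).inv₀ (by positivity)
  have h := (hg.mul (tendsto_sqrt_mul_exp_mul_K0.comp hX)).mul ((hE.const_add 1).div_const 2)
  rw [add_zero] at h
  exact h

theorem K0_mul_cosh_eq {c ν t s t₀ : ℝ} (hc : 0 < c) (hν : 0 < ν) (ht : 0 < t) :
    ν * Real.exp (2 * ν * s - 2 * ν * t₀) *
        (K0 (2 * (c * ν) * Real.sinh t) * Real.cosh (2 * ν * t)) =
      √ν * (Real.exp (-ν * (2 * (c * Real.sinh t - t - (s - t₀)))) *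
        nicholsonAmplitude c ν t) := by
  have hs := Real.sinh_pos_iff.2 ht
  have hsq : √(2 * (c * ν) * Real.sinh t) = √ν * √(2 * (c * Real.sinh t)) := by
    rw [← Real.sqrt_mul hν.le]
    congr 1
    ring
  have hne : √(2 * (c * Real.sinh t)) ≠ 0 := by positivity
  have hcosh : Real.cosh (2 * ν * t)
      = Real.exp (2 * ν * t) * ((1 + Real.exp (-4 * ν * t)) / 2) := by
    rw [Real.cosh_eq, mul_div_assoc', mul_add, mul_one, ← Real.exp_add]
    ring_nf
  have hexp : Real.exp (2 * ν * s - 2 * ν * t₀) * Real.exp (2 * ν * t)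
      = Real.exp (-ν * (2 * (c * Real.sinh t - t - (s - t₀)))) *
        Real.exp (2 * (c * ν) * Real.sinh t) := by
    rw [← Real.exp_add, ← Real.exp_add]
    ring_nf
  unfold nicholsonAmplitude
  rw [hcosh, hsq]
  calc _ = ν * (Real.exp (2 * ν * s - 2 * ν * t₀) * Real.exp (2 * ν * t)) *
        K0 (2 * (c * ν) * Real.sinh t) * ((1 + Real.exp (-4 * ν * t)) / 2) := by ring
    _ = (√ν * √ν) * (√(2 * (c * Real.sinh t)) * (√(2 * (c * Real.sinh t)))⁻¹) *
        (Real.exp (2 * ν * s - 2 * ν * t₀) * Real.exp (2 * ν * t)) *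
        K0 (2 * (c * ν) * Real.sinh t) * ((1 + Real.exp (-4 * ν * t)) / 2) := by
      rw [Real.mul_self_sqrt hν.le, mul_inv_cancel₀ hne, mul_one]
    _ = _ := by rw [hexp]; ring

/-- The contribution to a Laplace integral of a region where the phase is bounded below by a
positive constant vanishes. -/
theorem tendsto_sqrt_mul_integral_exp_neg_mul_zero {S : Set ℝ} {φ g : ℝ → ℝ} {h : ℝ → ℝ → ℝ}
    {δ : ℝ} (hSm : MeasurableSet S) (hδ : 0 < δ) (hφ : ∀ t ∈ S, δ ≤ φ t)
    (hg : IntegrableOn g S) (hh : ∀ ν > 0, ∀ t ∈ S, |h ν t| ≤ g t) :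
    Tendsto (fun ν => √ν * ∫ t in S, Real.exp (-ν * φ t) * h ν t) atTop (nhds 0) := by
  have hlim : Tendsto (fun ν : ℝ => √ν * (Real.exp (-δ * ν) * ∫ t in S, g t)) atTop (nhds 0) := by
    have := (tendsto_rpow_mul_exp_neg_mul_atTop_nhds_zero (1 / 2) δ hδ).mul_const (∫ t in S, g t)
    simpa [Real.sqrt_eq_rpow, mul_assoc] using this
  refine squeeze_zero_norm' ?_ hlim
  filter_upwards [eventually_gt_atTop 0] with ν hν
  rw [norm_mul, Real.norm_of_nonneg (Real.sqrt_nonneg ν), ← integral_const_mul]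
  refine mul_le_mul_of_nonneg_left ?_ (Real.sqrt_nonneg ν)
  refine norm_integral_le_of_norm_le (hg.const_mul _) ?_
  filter_upwards [ae_restrict_mem hSm] with t ht
  rw [norm_mul, Real.norm_eq_abs, Real.norm_eq_abs, Real.abs_exp]
  refine mul_le_mul (Real.exp_le_exp.2 ?_) (hh ν hν t ht) (abs_nonneg _) (Real.exp_pos _).le
  linarith [mul_le_mul_of_nonneg_left (hφ t ht) hν.le]

theorem integrableOn_inv_sqrt_sinh {c a : ℝ} (hc : 0 < c) :
    IntegrableOn (fun t => (√(2 * (c * Real.sinh t)))⁻¹ * √(π / 2)) (Ioc 0 a) := by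
  refine Integrable.mul_const ?_ _
  have hr : IntegrableOn (fun t : ℝ => (√(2 * c))⁻¹ * t ^ (-(1 / 2) : ℝ)) (Ioc 0 a) :=
    ((intervalIntegral.intervalIntegrable_rpow' (a := 0) (b := a) (by norm_num)).1).const_mul _
  refine Integrable.mono' hr (by fun_prop) ?_
  filter_upwards [ae_restrict_mem measurableSet_Ioc] with t ht
  have h1 : t ≤ Real.sinh t := Real.self_le_sinh_iff.2 ht.1.le
  have ht0 : 0 < t := ht.1
  rw [Real.norm_of_nonneg (by positivity), Real.rpow_neg ht0.le, ← Real.sqrt_eq_rpow, ← mul_inv,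
    ← Real.sqrt_mul (by positivity), mul_assoc]
  gcongr

theorem tendsto_sqrt_mul_integral_nicholson {c s t₀ : ℝ} (hc : 0 < c) (ht₀ : 0 < t₀)
    (hcosh : c * Real.cosh t₀ = 1) (hsinh : c * Real.sinh t₀ = s) :
    Tendsto (fun ν => √ν * ∫ t in Ioi 0,
      Real.exp (-ν * (2 * (c * Real.sinh t - t - (s - t₀)))) * nicholsonAmplitude c ν t) atTop
      (nhds (√(π / s) * ((√(2 * s))⁻¹ * √(π / 2) * (1 / 2)))) := by
  set φ : ℝ → ℝ := fun t => 2 * (c * Real.sinh t - t - (s - t₀)) with hφ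
  have ha : 0 < t₀ / 2 := by positivity
  set a := t₀ / 2
  have hat : a < t₀ := half_lt_self ht₀
  have hd1 : ∀ t, HasDerivAt φ (2 * (c * Real.cosh t - 1)) t := fun t =>
    ((((Real.hasDerivAt_sinh t).const_mul c).sub (hasDerivAt_id t)).sub_const _).const_mul 2
  have hd2 : ∀ t, HasDerivAt (fun t => 2 * (c * Real.cosh t - 1)) (2 * (c * Real.sinh t)) t :=
    fun t => (((Real.hasDerivAt_cosh t).const_mul c).sub_const 1).const_mul 2
  have h0 : φ t₀ = 0 := by simp only [hφ, hsinh]; ring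
  have h0' : 2 * (c * Real.cosh t₀ - 1) = 0 := by rw [hcosh]; ring
  have hquad : ∀ t ∈ Ioi (a / 2), c * Real.sinh (a / 2) * (t - t₀) ^ 2 ≤ φ t := by
    intro t ht
    refine mul_sq_le_of_le_deriv2 isOpen_Ioi (convex_Ioi (a / 2)) ?_ hd1 hd2 h0 h0' ?_ ht
    · exact (half_lt_self ha).trans hat
    · intro x hx
      have := Real.sinh_le_sinh.2 (le_of_lt hx)
      gcongr
  have hm : 0 < c * Real.sinh (a / 2) := mul_pos hc (Real.sinh_pos_iff.2 (by positivity))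
  have hanti : AntitoneOn φ (Icc 0 t₀) := by
    refine antitoneOn_of_deriv_nonpos (convex_Icc 0 t₀)
      (fun t _ => (hd1 t).continuousAt.continuousWithinAt)
      (fun t _ => (hd1 t).differentiableAt.differentiableWithinAt) fun t ht => ?_
    rw [interior_Icc] at ht
    rw [(hd1 t).deriv]
    have : Real.cosh t ≤ Real.cosh t₀ := by
      rw [Real.cosh_le_cosh, abs_of_pos ht.1, abs_of_pos ht₀]
      exact ht.2.le
    have := mul_le_mul_of_nonneg_left this hc.le
    linarith
  have hδ : 0 < φ a :=
    (mul_pos hm (by nlinarith [mul_pos (sub_pos.2 hat) (sub_pos.2 hat)])).trans_le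
      (hquad a (half_lt_self ha))
  have hφm : Measurable φ := by fun_prop
  have hg := integrableOn_inv_sqrt_sinh (a := a) hc
  have habs : ∀ ν > 0, ∀ t > 0,
      |nicholsonAmplitude c ν t| ≤ (√(2 * (c * Real.sinh t)))⁻¹ * √(π / 2) := by
    intro ν hν t ht
    rw [abs_of_nonneg (nicholsonAmplitude_nonneg c ν t)]
    exact nicholsonAmplitude_le hc hν ht
  have habs' : ∀ ν > 0, ∀ t ∈ Ioi a,
      |nicholsonAmplitude c ν t| ≤ (√(2 * (c * Real.sinh a)))⁻¹ * √(π / 2) := by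
    intro ν hν t ht
    refine (habs ν hν t (ha.trans ht)).trans ?_
    have := Real.sinh_le_sinh.2 (le_of_lt ht)
    gcongr
  have hleft := tendsto_sqrt_mul_integral_exp_neg_mul_zero (S := Ioc 0 a) (φ := φ)
    (h := nicholsonAmplitude c) measurableSet_Ioc hδ
    (fun t ht => hanti ⟨ht.1.le, ht.2.trans hat.le⟩ ⟨ha.le, hat.le⟩ ht.2) hg
    (fun ν hν t ht => habs ν hν t ht.1)
  have hright := tendsto_sqrt_mul_integral_exp_neg_mul (S := Ioi a) (φ := φ)
    (h := nicholsonAmplitude c) (Ioi_mem_nhds hat) measurableSet_Ioi hφm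
    (measurable_nicholsonAmplitude c)
    ((eventually_gt_atTop 0).mono habs') hm
    (fun t ht => hquad t ((half_lt_self ha).trans ht))
    (tendsto_div_sq_of_hasDerivAt hd1 (hd2 t₀) h0 h0') (tendsto_nicholsonAmplitude hc ht₀)
  have h := hleft.add hright
  rw [zero_add, hsinh] at h
  refine h.congr' ?_
  filter_upwards [eventually_gt_atTop 0] with ν hν
  have hmeas : Measurable fun t => Real.exp (-ν * φ t) * nicholsonAmplitude c ν t :=
    ((hφm.const_mul (-ν)).exp).mul (measurable_nicholsonAmplitude c ν)
  rw [← mul_add, ← Ioc_union_Ioi_eq_Ioi ha.le, setIntegral_union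
    (Ioc_disjoint_Ioi le_rfl) measurableSet_Ioi]
  · refine Integrable.mono' hg hmeas.aestronglyMeasurable ?_
    filter_upwards [ae_restrict_mem measurableSet_Ioc] with t ht
    rw [norm_mul, Real.norm_eq_abs, Real.norm_eq_abs, Real.abs_exp]
    refine (mul_le_of_le_one_left (abs_nonneg _) (Real.exp_le_one_iff.2 ?_)).trans
      (habs ν hν t ht.1)
    have := hδ.trans_le (hanti ⟨ht.1.le, ht.2.trans hat.le⟩ ⟨ha.le, hat.le⟩ ht.2)
    nlinarith
  · refine Integrable.mono' (((integrable_exp_neg_mul_sq (mul_pos hν hm)).comp_sub_right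
      t₀).integrableOn.mul_const ((√(2 * (c * Real.sinh a)))⁻¹ * √(π / 2)))
      hmeas.aestronglyMeasurable ?_
    filter_upwards [ae_restrict_mem measurableSet_Ioi] with t ht
    rw [norm_mul, Real.norm_eq_abs, Real.norm_eq_abs, Real.abs_exp]
    refine mul_le_mul (Real.exp_le_exp.2 ?_) (habs' ν hν t ht) (abs_nonneg _) (Real.exp_pos _).le
    have := mul_le_mul_of_nonneg_left (hquad t ((half_lt_self ha).trans ht)) hν.le
    linarith

/-- Refined asymptotics of `M²` in the Debye regime `z = cν`, `0 < c < 1`. -/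
theorem M2_debye_regime_lt_one (c : ℝ) (hc0 : 0 < c) (hc1 : c < 1) :
    Tendsto (fun ν : ℝ =>
        (π / 2) * ν * Real.sqrt (1 - c ^ 2) *
          Real.exp (2 * ν * Real.sqrt (1 - c ^ 2)
            - 2 * ν * Real.log (1 / c + Real.sqrt (1 / c ^ 2 - 1))) *
          M2 ν (c * ν)) atTop (nhds 1) := by
  have hc2 : 0 < 1 - c ^ 2 := by nlinarith
  have h1c : 1 < 1 / c := by rwa [lt_div_iff₀ hc0, one_mul]
  obtain ⟨s, hs⟩ : ∃ s, s = √(1 - c ^ 2) := ⟨_, rfl⟩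
  obtain ⟨t₀, ht⟩ : ∃ t₀, t₀ = Real.arcosh (1 / c) := ⟨_, rfl⟩
  have hs0 : 0 < s := hs ▸ Real.sqrt_pos.2 hc2
  have ht0 : 0 < t₀ := ht ▸ Real.arcosh_pos h1c
  have hlog : Real.log (1 / c + √(1 / c ^ 2 - 1)) = t₀ := by
    rw [ht, Real.arcosh, div_pow, one_pow]
  have hcosh : c * Real.cosh t₀ = 1 := by
    rw [ht, Real.cosh_arcosh h1c.le, mul_one_div_cancel hc0.ne']
  have hsinh : c * Real.sinh t₀ = s := by
    rw [ht, Real.sinh_arcosh h1c.le, hs, show 1 - c ^ 2 = c ^ 2 * ((1 / c) ^ 2 - 1) by field_simp,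
      Real.sqrt_mul (sq_nonneg c), Real.sqrt_sq hc0.le]
  rw [hlog, ← hs]
  have h := (tendsto_sqrt_mul_integral_nicholson hc0 ht0 hcosh hsinh).const_mul (4 * s / π)
  have hval : 4 * s / π * (√(π / s) * ((√(2 * s))⁻¹ * √(π / 2) * (1 / 2))) = 1 := by
    have : √(π / s) * ((√(2 * s))⁻¹ * √(π / 2)) = π / (2 * s) := by
      rw [← Real.sqrt_inv, ← Real.sqrt_mul (by positivity), ← Real.sqrt_mul (by positivity),
        show π / s * ((2 * s)⁻¹ * (π / 2)) = (π / (2 * s)) ^ 2 by field_simp,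
        Real.sqrt_sq (by positivity)]
    rw [← mul_assoc (√(π / s)), this]
    field_simp
    norm_num
  rw [hval] at h
  refine h.congr' ?_
  filter_upwards [eventually_gt_atTop 0] with ν hν
  have hint : √ν * ∫ t in Ioi 0, Real.exp (-ν * (2 * (c * Real.sinh t - t - (s - t₀)))) *
      nicholsonAmplitude c ν t = ν * Real.exp (2 * ν * s - 2 * ν * t₀) *
        ∫ t in Ioi 0, K0 (2 * (c * ν) * Real.sinh t) * Real.cosh (2 * ν * t) := by
    rw [← integral_const_mul, ← integral_const_mul]
    exact setIntegral_congr_fun measurableSet_Ioi fun t ht => (K0_mul_cosh_eq hc0 hν ht).symm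
  rw [hint, M2]
  field_simp
  ring
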